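/- Define v₀ := −(1/m) Σ_{i=1}^m aᵢ·𝟙{⟨aᵢ, x⋆⟩ > 0}. There exists a universal constant C > 0 such that if ‖x⋆‖ ≥ 1, m ≥ C·d·‖x⋆‖², and 0 < η ≤ 1/2, then with probability at least 1 − 2·exp(−d) − exp(−d/2) the following three statements hold simultaneously: (i) −⟨v₀, x⋆⟩ ≥ ‖x⋆‖·(1/√(2π) − √(2d/m)); (ii) ‖v₀‖ ≤ 1 + 2·√(d/m); (iii) the point x₁ := 0 − η·(f(0)/‖v₀‖²)·v₀ satisfies ‖x₁ − x⋆‖ ≤ ‖x⋆‖·(1 − η/(10·√π·‖x⋆‖))^{1/2}. -/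

import Mathlib

open MeasureTheory ProbabilityTheory Real
open scoped RealInnerProductSpace ENNReal BigOperators Classical

noncomputable section

/-- Standard Gaussian measure `N(0, I_d)` on `ℝ^d`. -/
def stdGaussian (d : ℕ) : Measure (EuclideanSpace ℝ (Fin d)) :=
  (Measure.pi fun _ : Fin d => gaussianReal 0 1).map (EuclideanSpace.equiv (Fin d) ℝ).symm

/-- The joint distribution of `m` i.i.d. standard Gaussian vectors in `ℝ^d`. -/
def iidGaussian (d m : ℕ) : Measure (Fin m → EuclideanSpace ℝ (Fin d)) :=
  Measure.pi fun _ : Fin m => stdGaussian d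

/-- The loss `f(x) = (1/m) ∑ᵢ |yᵢ - hᵢ(x)|` where `yᵢ = 1 - exp(-⟨aᵢ,x⋆⟩₊)` and
`hᵢ(x) = 1 - exp(-⟨aᵢ,x⟩₊)`. -/
def loss {d m : ℕ} (xstar : EuclideanSpace ℝ (Fin d))
    (a : Fin m → EuclideanSpace ℝ (Fin d)) (x : EuclideanSpace ℝ (Fin d)) : ℝ :=
  (1 / m) * ∑ i, |(1 - Real.exp (-max ⟪a i, xstar⟫ 0)) - (1 - Real.exp (-max ⟪a i, x⟫ 0))|

/-- The complementary error function `erfc(t) = (2/√π) ∫_t^∞ exp(-u²) du`. -/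
def erfc (t : ℝ) : ℝ := 2 / Real.sqrt π * ∫ u in Set.Ioi t, Real.exp (-u ^ 2)

/-- The subgradient selection at the origin, `v₀ = -(1/m) ∑ᵢ aᵢ 𝟙{⟨aᵢ,x⋆⟩ > 0}`. -/
def v0 {d m : ℕ} (xstar : EuclideanSpace ℝ (Fin d))
    (a : Fin m → EuclideanSpace ℝ (Fin d)) : EuclideanSpace ℝ (Fin d) :=
  -((1 / m : ℝ) • ∑ i, if 0 < ⟪a i, xstar⟫ then a i else 0)

lemma aux_std_eq (d : ℕ) : _root_.stdGaussian d
    = ProbabilityTheory.stdGaussian (EuclideanSpace ℝ (Fin d)) := by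
  rw [← map_pi_eq_stdGaussian]; rfl

instance aux_prob_std (d : ℕ) : IsProbabilityMeasure (_root_.stdGaussian d) := by
  rw [aux_std_eq]; infer_instance

instance aux_prob_iid (d m : ℕ) : IsProbabilityMeasure (iidGaussian d m) := by
  unfold iidGaussian; infer_instance

lemma aux_map_inner (d : ℕ) (w : EuclideanSpace ℝ (Fin d)) :
    (_root_.stdGaussian d).map (fun a => ⟪a, w⟫) = gaussianReal 0 (‖w‖ ^ 2).toNNReal := by
  have h := IsGaussian.map_eq_gaussianReal
    (μ := ProbabilityTheory.stdGaussian (EuclideanSpace ℝ (Fin d))) (innerSL ℝ w)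
  rw [integral_strongDual_stdGaussian, variance_dual_stdGaussian, innerSL_apply_norm] at h
  rw [aux_std_eq, ← h]
  congr 1
  ext a
  simp [real_inner_comm]

/-- unscaled version -/
lemma aux_map_inner' (d : ℕ) (w : EuclideanSpace ℝ (Fin d)) :
    (_root_.stdGaussian d).map (fun a => ⟪a, w⟫) =
      (gaussianReal 0 1).map (fun g => ‖w‖ * g) := by
  rw [aux_map_inner, gaussianReal_map_const_mul]
  congr 1
  · simp
  · ext; simp

lemma aux_lintegral_pi {ι : Type*} [Fintype ι] {E : Type*} [MeasurableSpace E]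
    (μ : Measure E) [IsProbabilityMeasure μ] (f : E → ℝ≥0∞) (hf : Measurable f) :
    ∫⁻ a, ∏ i, f (a i) ∂(Measure.pi fun _ : ι => μ) = (∫⁻ x, f x ∂μ) ^ Fintype.card ι := by
  have h := iIndepFun_pi (μ := fun _ : ι => μ) (X := fun _ => f) (fun i => hf.aemeasurable)
  rw [lintegral_prod_eq_prod_lintegral_of_indepFun Finset.univ (fun (i : ι) (a : ι → E) => f (a i)) h
    (fun i => hf.comp (measurable_pi_apply i))]
  have : ∀ i, ∫⁻ a, f (a i) ∂(Measure.pi fun _ : ι => μ) = ∫⁻ x, f x ∂μ := fun i => by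
    rw [(measurePreserving_eval (fun _ : ι => μ) i).lintegral_comp hf]
  simp [this]

lemma aux_int_sq : Integrable (fun g : ℝ => g ^ 2) (gaussianReal 0 1) :=
  (memLp_id_gaussianReal (μ := 0) (v := 1) 2).integrable_sq

lemma aux_int_id : Integrable (fun g : ℝ => g) (gaussianReal 0 1) :=
  (memLp_id_gaussianReal (μ := 0) (v := 1) 1).integrable (by simp)

lemma aux_int_pos : Integrable (fun g : ℝ => max g 0) (gaussianReal 0 1) :=
  aux_int_id.pos_part

lemma aux_int_pos_sq : Integrable (fun g : ℝ => (max g 0) ^ 2) (gaussianReal 0 1) := by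
  refine aux_int_sq.mono' (by fun_prop) (ae_of_all _ fun g => ?_)
  rw [Real.norm_of_nonneg (by positivity)]
  rcases max_cases g 0 with ⟨h, _⟩ | ⟨h, _⟩ <;> rw [h] <;> nlinarith [sq_nonneg g]

lemma aux_sq_val : ∫ g, g ^ 2 ∂(gaussianReal 0 1) = 1 := by
  have h := variance_eq_sub (memLp_id_gaussianReal (μ := 0) (v := 1) 2)
  rw [variance_id_gaussianReal] at h
  simpa using h.symm

lemma aux_pos_sq_val : ∫ g, (max g 0) ^ 2 ∂(gaussianReal 0 1) = 1 / 2 := by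
  have h1 : ∫ g, (max (-g) 0) ^ 2 ∂(gaussianReal 0 1) = ∫ g, (max g 0) ^ 2 ∂(gaussianReal 0 1) := by
    have := integral_map (μ := gaussianReal 0 1) (φ := fun x : ℝ => -x) (by fun_prop)
      (f := fun g : ℝ => (max g 0) ^ 2) (by fun_prop)
    rw [gaussianReal_map_neg, neg_zero] at this
    exact this.symm
  have h2 : Integrable (fun g : ℝ => (max (-g) 0) ^ 2) (gaussianReal 0 1) := by
    refine aux_int_sq.mono' (by fun_prop) (ae_of_all _ fun g => ?_)
    rw [Real.norm_of_nonneg (by positivity)]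
    rcases max_cases (-g) 0 with ⟨h, _⟩ | ⟨h, _⟩ <;> rw [h] <;> nlinarith [sq_nonneg g]
  have h3 := integral_add aux_int_pos_sq h2
  have h4 : ∀ g : ℝ, (max g 0) ^ 2 + (max (-g) 0) ^ 2 = g ^ 2 := by
    intro g
    rcases le_total g 0 with h | h
    · rw [max_eq_right h, max_eq_left (by linarith)]; ring
    · rw [max_eq_left h, max_eq_right (by linarith)]; ring
  simp_rw [h4, aux_sq_val, h1] at h3
  linarith

lemma aux_pos_val : ∫ g, max g 0 ∂(gaussianReal 0 1) = 1 / √(2 * π) := by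
  rw [integral_gaussianReal_eq_integral_smul (by simp)]
  have h1 : (fun x : ℝ => gaussianPDFReal 0 1 x • max x 0) =
      (Set.Ioi (0:ℝ)).indicator (fun x => (√(2 * π))⁻¹ * (x ^ (1:ℝ) * rexp (-(1/2) * x ^ (2:ℝ)))) := by
    ext x
    by_cases hx : 0 < x
    · rw [Set.indicator_of_mem (by exact hx), max_eq_left hx.le, gaussianPDFReal_def]
      simp only [smul_eq_mul, rpow_one, rpow_two, NNReal.coe_one, mul_one, sub_zero]
      rw [show -x ^ 2 / 2 = -(1/2) * x ^ 2 by ring]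
      ring
    · rw [Set.indicator_of_notMem (by exact hx), max_eq_right (not_lt.1 hx)]; simp
  rw [h1, integral_indicator measurableSet_Ioi, integral_const_mul,
    integral_rpow_mul_exp_neg_mul_rpow (by norm_num) (by norm_num) (by norm_num)]
  norm_num [Real.rpow_neg_one]

lemma aux_exp_sq : ∫⁻ g, ENNReal.ofReal (rexp (7 / 16 * g ^ 2)) ∂(gaussianReal 0 1)
    = ENNReal.ofReal (√8) := by
  rw [gaussianReal_of_var_ne_zero _ (by simp), 
    lintegral_withDensity_eq_lintegral_mul _ (measurable_gaussianPDF 0 1) (by fun_prop)]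
  have h1 : ∀ x : ℝ, (gaussianPDF 0 1 * fun g => ENNReal.ofReal (rexp (7 / 16 * g ^ 2))) x
      = ENNReal.ofReal ((√(2 * π))⁻¹ * rexp (-(1/16) * x ^ 2)) := by
    intro x
    rw [Pi.mul_apply, gaussianPDF, ← ENNReal.ofReal_mul (gaussianPDFReal_nonneg _ _ _),
      gaussianPDFReal_def, mul_assoc, ← Real.exp_add]
    congr 3
    · simp
    · simp; ring
  simp_rw [h1]
  rw [← ofReal_integral_eq_lintegral_ofReal, integral_const_mul, integral_gaussian]
  · congr 1
    rw [show π / (1/16) = 8 * (2 * π) by ring,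
      Real.sqrt_mul (by norm_num : (0:ℝ) ≤ 8) (2 * π), mul_comm (√8), ← mul_assoc,
      inv_mul_cancel₀ (by positivity), one_mul]
  · exact (integrable_exp_neg_mul_sq (by norm_num)).const_mul _
  · exact ae_of_all _ fun x => by positivity

lemma aux_exp_neg_le (x : ℝ) (hx : 0 ≤ x) : rexp (-x) ≤ 1 - x + x ^ 2 / 2 := by
  have h1 := Real.quadratic_le_exp_of_nonneg hx
  rw [Real.exp_neg]
  rw [inv_le_iff_one_le_mul₀ (Real.exp_pos x)]
  have h3 : 0 ≤ 1 - x + x ^ 2 / 2 := by nlinarith [sq_nonneg (x - 1)]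
  nlinarith [mul_le_mul_of_nonneg_left h1 h3, sq_nonneg (x^2)]

/-- lower tail for functions of a scalar gaussian -/
lemma aux_lower_tail (d m : ℕ) (w : EuclideanSpace ℝ (Fin d)) (hw : ‖w‖ = 1)
    (X : ℝ → ℝ) (hX : Measurable X) (h0 : ∀ g, 0 ≤ X g) (h1 : ∀ g, X g ≤ max g 0)
    (μ t : ℝ) (hμ : μ ≤ ∫ g, X g ∂(gaussianReal 0 1)) (ht : 0 ≤ t) :
    iidGaussian d m {a | ∑ i, X ⟪a i, w⟫ < m * (μ - t)} ≤ ENNReal.ofReal (rexp (-(m * t ^ 2))) := by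
  set lam := 2 * t with hlam
  let F : EuclideanSpace ℝ (Fin d) → ℝ≥0∞ := fun x => ENNReal.ofReal (rexp (-(lam * X ⟪x, w⟫)))
  have hF : Measurable F := by fun_prop
  have hmap : (_root_.stdGaussian d).map (fun a => ⟪a, w⟫) = gaussianReal 0 1 := by
    rw [aux_map_inner, hw]; simp
  have hint : Integrable X (gaussianReal 0 1) := by
    refine aux_int_pos.mono' hX.aestronglyMeasurable (ae_of_all _ fun g => ?_)
    rw [Real.norm_of_nonneg (h0 g)]; exact h1 g
  have hA : Integrable (fun g => 1 - lam * X g) (gaussianReal 0 1) :=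
    (integrable_const _).sub (hint.const_mul _)
  have hint2 : Integrable (fun g => 1 - lam * X g + lam ^ 2 / 2 * (max g 0) ^ 2)
      (gaussianReal 0 1) :=
    hA.add (aux_int_pos_sq.const_mul _)
  have hpt : ∀ g, rexp (-(lam * X g)) ≤ 1 - lam * X g + lam ^ 2 / 2 * (max g 0) ^ 2 := by
    intro g
    have := aux_exp_neg_le (lam * X g) (mul_nonneg (by positivity) (h0 g))
    have h2 : (X g) ^ 2 ≤ (max g 0) ^ 2 := pow_le_pow_left₀ (h0 g) (h1 g) 2
    nlinarith [mul_le_mul_of_nonneg_left h2 (sq_nonneg lam)]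
  have hone : ∫⁻ x, F x ∂(_root_.stdGaussian d) ≤ ENNReal.ofReal (rexp (-lam * μ + lam ^ 2 / 4)) := by
    have e1 : ∫⁻ x, F x ∂(_root_.stdGaussian d)
        = ∫⁻ g, ENNReal.ofReal (rexp (-(lam * X g))) ∂(gaussianReal 0 1) := by
      rw [← hmap, lintegral_map (by fun_prop) (by fun_prop)]
    rw [e1]
    calc _ ≤ ∫⁻ g, ENNReal.ofReal (1 - lam * X g + lam ^ 2 / 2 * (max g 0) ^ 2) ∂(gaussianReal 0 1) :=
          lintegral_mono fun g => ENNReal.ofReal_le_ofReal (hpt g)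
      _ = ENNReal.ofReal (∫ g, (1 - lam * X g + lam ^ 2 / 2 * (max g 0) ^ 2) ∂(gaussianReal 0 1)) := by
          rw [ofReal_integral_eq_lintegral_ofReal hint2]
          exact ae_of_all _ fun g => (Real.exp_pos _).le.trans (hpt g)
      _ ≤ _ := by
          apply ENNReal.ofReal_le_ofReal
          rw [integral_add hA
            (aux_int_pos_sq.const_mul _), integral_sub (integrable_const _) (hint.const_mul _),
            integral_const_mul, integral_const_mul, aux_pos_sq_val]
          simp only [integral_const, probReal_univ, smul_eq_mul, mul_one]
          have := Real.add_one_le_exp (-lam * μ + lam ^ 2 / 4)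
          have h3 : lam * μ ≤ lam * ∫ g, X g ∂(gaussianReal 0 1) :=
            mul_le_mul_of_nonneg_left hμ (by positivity)
          linarith
  have hpi : ∫⁻ a, ∏ i, F (a i) ∂(iidGaussian d m)
      ≤ ENNReal.ofReal (rexp (m * (-lam * μ + lam ^ 2 / 4))) := by
    unfold iidGaussian
    rw [aux_lintegral_pi _ F hF, Fintype.card_fin, Real.exp_nat_mul,
      ENNReal.ofReal_pow (Real.exp_pos _).le]
    exact pow_le_pow_left' hone m
  have hprod : ∀ a : Fin m → EuclideanSpace ℝ (Fin d),
      ∏ i, F (a i) = ENNReal.ofReal (rexp (-(lam * ∑ i, X ⟪a i, w⟫))) := by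
    intro a
    simp only [F]
    rw [← ENNReal.ofReal_prod_of_nonneg (fun i _ => (Real.exp_pos _).le), ← Real.exp_sum,
      Finset.sum_neg_distrib, Finset.mul_sum]
  calc _ ≤ iidGaussian d m {a | ENNReal.ofReal (rexp (-(lam * (m * (μ - t))))) ≤ ∏ i, F (a i)} := by
        apply measure_mono
        intro a ha
        simp only [Set.mem_ofPred_eq] at ha ⊢
        rw [hprod]
        apply ENNReal.ofReal_le_ofReal
        apply Real.exp_le_exp.2
        have : 0 ≤ lam := by positivity
        nlinarith
    _ ≤ (∫⁻ a, ∏ i, F (a i) ∂(iidGaussian d m)) / ENNReal.ofReal (rexp (-(lam * (m * (μ - t))))) :=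
        meas_ge_le_lintegral_div (Finset.aemeasurable_fun_prod _ fun i _ =>
            (hF.comp (measurable_pi_apply i)).aemeasurable)
          (by simp [Real.exp_pos]) (by simp)
    _ ≤ _ := by
        apply ENNReal.div_le_of_le_mul
        refine hpi.trans ?_
        rw [← ENNReal.ofReal_mul (Real.exp_pos _).le, ← Real.exp_add]
        apply ENNReal.ofReal_le_ofReal
        apply Real.exp_le_exp.2
        apply le_of_eq
        rw [hlam]; ring

lemma aux_mgf_le (s : ℝ) (hs : 0 ≤ s) :
    ∫⁻ g, ENNReal.ofReal (rexp (max (s * g) 0)) ∂(gaussianReal 0 1)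
      ≤ ENNReal.ofReal (rexp (3 / 4 * s + s ^ 2 / 2)) := by
  -- pointwise bound
  have hpt : ∀ x : ℝ, rexp (max x 0) ≤ rexp x + 1 / 4 * rexp (-x) := by
    intro x
    rcases le_total x 0 with h | h
    · rw [max_eq_right h, Real.exp_zero]
      have h1 : rexp x * rexp (-x) = 1 := by rw [← Real.exp_add]; simp
      have := Real.exp_pos x
      have := Real.exp_pos (-x)
      nlinarith [sq_nonneg (rexp x - 1 / 4 * rexp (-x)), sq_nonneg (rexp x + 1/4 * rexp (-x) + 1)]
    · rw [max_eq_left h]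
      have := Real.exp_pos (-x)
      linarith
  have hi : ∀ c : ℝ, Integrable (fun g => rexp (c * g) + 1 / 4 * rexp (-(c * g)))
      (gaussianReal 0 1) := by
    intro c
    refine (integrable_exp_mul_gaussianReal c).add (Integrable.const_mul ?_ _)
    simpa using integrable_exp_mul_gaussianReal (μ := 0) (v := 1) (-c)
  have hv : ∀ c : ℝ, ∫ g, (rexp (c * g) + 1 / 4 * rexp (-(c * g))) ∂(gaussianReal 0 1)
      = 5 / 4 * rexp (c ^ 2 / 2) := by
    intro c
    have i1 := integrable_exp_mul_gaussianReal (μ := 0) (v := 1) c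
    have i2 := integrable_exp_mul_gaussianReal (μ := 0) (v := 1) (-c)
    have e1 := congrFun (mgf_fun_id_gaussianReal (μ := 0) (v := 1)) c
    have e2 := congrFun (mgf_fun_id_gaussianReal (μ := 0) (v := 1)) (-c)
    simp only [mgf, zero_mul, zero_add, NNReal.coe_one, one_mul, neg_mul, neg_sq] at e1 e2 i2
    rw [integral_add i1 (i2.const_mul _), integral_const_mul, e1, e2]
    ring
  have key : ∀ f : ℝ → ℝ, Integrable f (gaussianReal 0 1) → (∀ g, rexp (max (s * g) 0) ≤ f g) →
      ∫ g, f g ∂(gaussianReal 0 1) ≤ rexp (3 / 4 * s + s ^ 2 / 2) →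
      ∫⁻ g, ENNReal.ofReal (rexp (max (s * g) 0)) ∂(gaussianReal 0 1)
        ≤ ENNReal.ofReal (rexp (3 / 4 * s + s ^ 2 / 2)) := by
    intro f hf hle hval
    calc _ ≤ ∫⁻ g, ENNReal.ofReal (f g) ∂(gaussianReal 0 1) :=
          lintegral_mono fun g => ENNReal.ofReal_le_ofReal (hle g)
      _ = ENNReal.ofReal (∫ g, f g ∂(gaussianReal 0 1)) := by
          rw [ofReal_integral_eq_lintegral_ofReal hf]
          exact ae_of_all _ fun g => (Real.exp_pos _).le.trans (hle g)
      _ ≤ _ := ENNReal.ofReal_le_ofReal hval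
  have h54 : (5 / 4 : ℝ) ≤ rexp (1 / 4) := by
    have := Real.add_one_le_exp (1 / 4 : ℝ); linarith
  rcases le_total 1 s with h1 | h1
  · refine key _ (hi s) (fun g => hpt _) ?_
    rw [hv, Real.exp_add]
    have : rexp (1 / 4) ≤ rexp (3 / 4 * s) := Real.exp_le_exp.2 (by linarith)
    exact mul_le_mul_of_nonneg_right (h54.trans this) (Real.exp_pos _).le
  · -- tangent line
    have hc : rexp (3 / 4) ≥ 5 / 4 * rexp (1 / 2) := by
      rw [show (3 / 4 : ℝ) = 1 / 4 + 1 / 2 by norm_num, Real.exp_add]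
      exact mul_le_mul_of_nonneg_right h54 (Real.exp_pos _).le
    refine key (fun g => rexp (3 / 4 * s) *
      ((1 - s) + s * rexp (-(3/4)) * (rexp (1 * g) + 1 / 4 * rexp (-(1 * g)))))
      ((Integrable.add (integrable_const _) ((hi 1).const_mul _)).const_mul _) ?_ ?_
    · intro g
      have e : max (s * g) 0 = s * max g 0 := by
        rw [mul_max_of_nonneg _ _ hs, mul_zero]
      have hconv := convexOn_exp.2 (Set.mem_univ (0:ℝ)) (Set.mem_univ (max g 0 - 3 / 4))
        (by linarith : 0 ≤ 1 - s) hs (by ring)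
      simp only [smul_eq_mul, mul_zero, zero_add, Real.exp_zero, mul_one] at hconv
      rw [e, show s * max g 0 = 3 / 4 * s + s * (max g 0 - 3 / 4) by ring, Real.exp_add]
      refine mul_le_mul_of_nonneg_left (hconv.trans ?_) (Real.exp_pos _).le
      rw [sub_eq_add_neg (max g 0), add_comm (max g 0), Real.exp_add, one_mul, mul_assoc]
      have := hpt g
      gcongr
    · rw [integral_const_mul, integral_add (integrable_const _) ((hi 1).const_mul _),
        integral_const_mul, hv]
      simp only [integral_const, probReal_univ, smul_eq_mul, one_mul]
      rw [Real.exp_add]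
      refine mul_le_mul_of_nonneg_left ?_ (Real.exp_pos _).le
      have h2 : rexp (-(3/4)) * (5 / 4 * rexp (1 ^ 2 / 2)) ≤ 1 := by
        rw [one_pow, Real.exp_neg, inv_mul_le_iff₀ (Real.exp_pos _)]; linarith
      have h3 : 1 ≤ rexp (s ^ 2 / 2) := Real.one_le_exp (by positivity)
      nlinarith

lemma aux_norm_mgf (d : ℕ) :
    ∫⁻ w, ENNReal.ofReal (rexp (7 / 16 * ‖w‖ ^ 2)) ∂(_root_.stdGaussian d)
      = ENNReal.ofReal (√8) ^ d := by
  unfold _root_.stdGaussian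
  rw [lintegral_map (by fun_prop) (by fun_prop)]
  have := aux_lintegral_pi (ι := Fin d) (gaussianReal 0 1)
    (fun g => ENNReal.ofReal (rexp (7 / 16 * g ^ 2))) (by fun_prop)
  rw [aux_exp_sq, Fintype.card_fin] at this
  rw [← this]
  refine lintegral_congr fun x => ?_
  rw [← ENNReal.ofReal_prod_of_nonneg (fun i _ => (Real.exp_pos _).le), ← Real.exp_sum,
    ← Finset.mul_sum, EuclideanSpace.real_norm_sq_eq]
  rfl

lemma aux_hs (d : ℕ) (v : EuclideanSpace ℝ (Fin d)) :
    ∫⁻ w, ENNReal.ofReal (rexp ⟪w, v⟫) ∂(_root_.stdGaussian d)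
      = ENNReal.ofReal (rexp (‖v‖ ^ 2 / 2)) := by
  have h1 : ∫⁻ w, ENNReal.ofReal (rexp ⟪w, v⟫) ∂(_root_.stdGaussian d)
      = ∫⁻ g, ENNReal.ofReal (rexp (‖v‖ * g)) ∂(gaussianReal 0 1) := by
    have e := lintegral_map (μ := _root_.stdGaussian d) (g := fun a => ⟪a, v⟫)
      (f := fun y : ℝ => ENNReal.ofReal (rexp y)) (by fun_prop) (by fun_prop)
    rw [aux_map_inner', lintegral_map (by fun_prop) (by fun_prop)] at e
    exact e.symm
  rw [h1, ← ofReal_integral_eq_lintegral_ofReal (integrable_exp_mul_gaussianReal _)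
    (ae_of_all _ fun _ => (Real.exp_pos _).le)]
  have e1 := congrFun (mgf_fun_id_gaussianReal (μ := 0) (v := 1)) ‖v‖
  simp only [mgf, zero_mul, zero_add, NNReal.coe_one, one_mul] at e1
  rw [e1]

lemma aux_pos_mgf (d : ℕ) (v : EuclideanSpace ℝ (Fin d)) :
    ∫⁻ a, ENNReal.ofReal (rexp (max ⟪a, v⟫ 0)) ∂(_root_.stdGaussian d)
      ≤ ENNReal.ofReal (rexp (3 / 4 * ‖v‖ + ‖v‖ ^ 2 / 2)) := by
  have e := lintegral_map (μ := _root_.stdGaussian d) (g := fun a => ⟪a, v⟫)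
      (f := fun y : ℝ => ENNReal.ofReal (rexp (max y 0))) (by fun_prop) (by fun_prop)
  rw [aux_map_inner', lintegral_map (by fun_prop) (by fun_prop)] at e
  rw [← e]
  exact aux_mgf_le _ (norm_nonneg v)

def auxS {d m : ℕ} (x : EuclideanSpace ℝ (Fin d)) (a : Fin m → EuclideanSpace ℝ (Fin d)) :
    EuclideanSpace ℝ (Fin d) := ∑ i, if 0 < ⟪a i, x⟫ then a i else 0

lemma aux_measS {d m : ℕ} (x : EuclideanSpace ℝ (Fin d)) :
    Measurable (auxS (m := m) x) := by
  unfold auxS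
  refine Finset.measurable_fun_sum _ fun i _ => ?_
  refine Measurable.ite ?_ (measurable_pi_apply i) measurable_const
  exact measurableSet_lt measurable_const (by fun_prop)

lemma aux_norm_tail (d m : ℕ) (hm : 1 ≤ m) (x : EuclideanSpace ℝ (Fin d)) :
    iidGaussian d m {a | (m : ℝ) < ‖auxS x a‖} ≤
      ENNReal.ofReal (rexp (-(m / 64)) * (√8) ^ d) := by
  have hm0 : (0:ℝ) < m := by exact_mod_cast hm
  obtain ⟨s, hs0, hs⟩ : ∃ s : ℝ, 0 ≤ s ∧ s ^ 2 * m = 1 / 8 :=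
    ⟨√(1 / (8 * m)), by positivity, by rw [Real.sq_sqrt (by positivity)]; field_simp⟩
  have hmS := aux_measS (m := m) x
  have hE : ∫⁻ a, ENNReal.ofReal (rexp (‖s • auxS x a‖ ^ 2 / 2)) ∂(iidGaussian d m)
      ≤ ENNReal.ofReal (rexp (3 * m / 64) * (√8) ^ d) := by
    simp_rw [← aux_hs]
    rw [lintegral_lintegral_swap (by fun_prop)]
    calc _ ≤ ∫⁻ w, ENNReal.ofReal (rexp (3 * m / 64)) * ENNReal.ofReal (rexp (7 / 16 * ‖w‖ ^ 2))
          ∂(_root_.stdGaussian d) := by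
          refine lintegral_mono fun w => ?_
          calc _ ≤ ∫⁻ a, ∏ i, ENNReal.ofReal (rexp (max ⟪a i, s • w⟫ 0)) ∂(iidGaussian d m) := by
                refine lintegral_mono fun a => ?_
                rw [← ENNReal.ofReal_prod_of_nonneg (fun i _ => (Real.exp_pos _).le),
                  ← Real.exp_sum]
                apply ENNReal.ofReal_le_ofReal
                apply Real.exp_le_exp.2
                rw [inner_smul_right, auxS, inner_sum, Finset.mul_sum]
                refine Finset.sum_le_sum fun i _ => ?_
                split_ifs
                · rw [inner_smul_right, real_inner_comm]; exact le_max_left _ _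
                · simp
            _ = (∫⁻ y, ENNReal.ofReal (rexp (max ⟪y, s • w⟫ 0)) ∂(_root_.stdGaussian d)) ^ m := by
                have := aux_lintegral_pi (ι := Fin m) (_root_.stdGaussian d)
                  (fun y => ENNReal.ofReal (rexp (max ⟪y, s • w⟫ 0))) (by fun_prop)
                rw [Fintype.card_fin] at this
                exact this
            _ ≤ (ENNReal.ofReal (rexp (3 / 4 * ‖s • w‖ + ‖s • w‖ ^ 2 / 2))) ^ m :=
                pow_le_pow_left' (aux_pos_mgf d _) m
            _ ≤ _ := by
                rw [← ENNReal.ofReal_pow (Real.exp_pos _).le, ← Real.exp_nat_mul,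
                  ← ENNReal.ofReal_mul (Real.exp_pos _).le, ← Real.exp_add]
                apply ENNReal.ofReal_le_ofReal
                apply Real.exp_le_exp.2
                rw [norm_smul, Real.norm_of_nonneg hs0]
                have h1 : (m * s) ^ 2 = m / 8 := by
                  calc (m * s) ^ 2 = m * (s ^ 2 * m) := by ring
                    _ = _ := by rw [hs]; ring
                have h2 : m * ((s * ‖w‖) ^ 2 / 2) = ‖w‖ ^ 2 / 16 := by
                  calc m * ((s * ‖w‖) ^ 2 / 2) = (s ^ 2 * m) * ‖w‖ ^ 2 / 2 := by ring
                    _ = _ := by rw [hs]; ring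
                nlinarith [sq_nonneg (m * s - ‖w‖)]
      _ = _ := by
          rw [lintegral_const_mul _ (by fun_prop), aux_norm_mgf,
            ← ENNReal.ofReal_pow (by positivity), ← ENNReal.ofReal_mul (Real.exp_pos _).le]
  calc _ ≤ iidGaussian d m {a | ENNReal.ofReal (rexp (m / 16)) ≤
            ENNReal.ofReal (rexp (‖s • auxS x a‖ ^ 2 / 2))} := by
        apply measure_mono
        intro a ha
        simp only [Set.mem_ofPred_eq] at ha ⊢
        apply ENNReal.ofReal_le_ofReal
        apply Real.exp_le_exp.2
        rw [norm_smul, Real.norm_of_nonneg hs0]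
        have h1 : (m : ℝ) ^ 2 ≤ ‖auxS x a‖ ^ 2 := pow_le_pow_left₀ hm0.le ha.le 2
        have h2 : s ^ 2 * m ^ 2 ≤ s ^ 2 * ‖auxS x a‖ ^ 2 :=
          mul_le_mul_of_nonneg_left h1 (sq_nonneg s)
        have h3 : s ^ 2 * (m:ℝ) ^ 2 = m / 8 := by
          calc s ^ 2 * (m:ℝ) ^ 2 = (s ^ 2 * m) * m := by ring
            _ = _ := by rw [hs]; ring
        rw [mul_pow]; linarith
    _ ≤ (∫⁻ a, ENNReal.ofReal (rexp (‖s • auxS x a‖ ^ 2 / 2)) ∂(iidGaussian d m)) /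
          ENNReal.ofReal (rexp (m / 16)) :=
        meas_ge_le_lintegral_div (by fun_prop) (by simp [Real.exp_pos]) (by simp)
    _ ≤ _ := by
        apply ENNReal.div_le_of_le_mul
        refine hE.trans ?_
        rw [← ENNReal.ofReal_mul (by positivity)]
        apply ENNReal.ofReal_le_ofReal
        rw [mul_right_comm, ← Real.exp_add]
        apply le_of_eq
        congr 2
        ring

lemma aux_norm_tail' (d m : ℕ) (hm : 1 ≤ m) (hmd : (10000:ℝ) * d ≤ m)
    (x : EuclideanSpace ℝ (Fin d)) :
    iidGaussian d m {a | (m : ℝ) < ‖auxS x a‖} ≤ ENNReal.ofReal (rexp (-(d:ℝ) / 2)) := by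
  refine (aux_norm_tail d m hm x).trans (ENNReal.ofReal_le_ofReal ?_)
  have h1 : √8 ≤ rexp 2 := by
    have : √8 ≤ 3 := by rw [Real.sqrt_le_left (by norm_num)]; norm_num
    have := Real.add_one_le_exp (2:ℝ)
    linarith
  calc _ ≤ rexp (-(m / 64)) * (rexp 2) ^ d := by gcongr
    _ = rexp (-(m / 64) + d * 2) := by rw [← Real.exp_nat_mul, Real.exp_add]
    _ ≤ _ := Real.exp_le_exp.2 (by
        have : (0:ℝ) ≤ d := by positivity
        linarith)

lemma aux_c_lower : (0.396 : ℝ) ≤ 1 / √(2 * π) := by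
  have h : √(2 * π) ≤ 2.52 := by
    rw [Real.sqrt_le_left (by norm_num)]
    have := Real.pi_lt_d2
    norm_num at this ⊢
    linarith
  rw [le_div_iff₀ (by positivity)]
  linarith

lemma aux_sqrtpi : (1.77 : ℝ) ≤ √π := by
  apply Real.le_sqrt_of_sq_le
  have := Real.pi_gt_d2
  norm_num at this ⊢
  linarith

/-- deterministic contraction -/
lemma aux_contract {d : ℕ} (v x : EuclideanSpace ℝ (Fin d)) (η f : ℝ) (hη : 0 < η)
    (hη' : η ≤ 1 / 2) (hx : 1 ≤ ‖x‖) (hP : 0.38 * ‖x‖ ≤ -⟪v, x⟫) (hf : 0.13 ≤ f)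
    (hfP : f ≤ -⟪v, x⟫) (hv : ‖v‖ ≤ 1) :
    ‖((0 : EuclideanSpace ℝ (Fin d)) - (η * f / ‖v‖ ^ 2) • v) - x‖
      ≤ ‖x‖ * √(1 - η / (10 * √π * ‖x‖)) := by
  have hx0 : 0 < ‖x‖ := by linarith
  have hv0 : 0 < ‖v‖ := by
    rw [norm_pos_iff]
    rintro rfl
    simp at hP
    linarith
  set P := -⟪v, x⟫ with hPdef
  have hpi := aux_sqrtpi
  have hsp : 0 < √π := by linarith
  have hnorm : ‖((0 : EuclideanSpace ℝ (Fin d)) - (η * f / ‖v‖ ^ 2) • v) - x‖ ^ 2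
      = ‖x‖ ^ 2 - (η * f / ‖v‖ ^ 2) * (2 * P - η * f) := by
    rw [norm_sub_sq_real, zero_sub, norm_neg, inner_neg_left, inner_smul_left, norm_smul, mul_pow,
      Real.norm_eq_abs, sq_abs]
    simp only [conj_trivial]
    rw [show ⟪v, x⟫ = -P by rw [hPdef]; ring]
    field_simp
    ring
  have hmain : η * ‖x‖ / (10 * √π) ≤ (η * f / ‖v‖ ^ 2) * (2 * P - η * f) := by
    have h1 : η * ‖x‖ / (10 * √π) ≤ η * ‖x‖ * 0.057 := by
      rw [div_le_iff₀ (by positivity)]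
      have : 0 < η * ‖x‖ := by positivity
      nlinarith
    have h2 : η * 0.13 ≤ η * f / ‖v‖ ^ 2 := by
      rw [le_div_iff₀ (by positivity)]
      have : ‖v‖ ^ 2 ≤ 1 := pow_le_one₀ hv0.le hv
      calc η * 0.13 * ‖v‖ ^ 2 ≤ η * 0.13 * 1 := by gcongr
        _ ≤ η * f := by rw [mul_one]; gcongr
    have h3 : 0.57 * ‖x‖ ≤ 2 * P - η * f := by
      have : η * f ≤ 1 / 2 * P := by
        calc η * f ≤ 1 / 2 * f := by gcongr
          _ ≤ _ := by linarith
      linarith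
    calc _ ≤ η * ‖x‖ * 0.057 := h1
      _ ≤ (η * 0.13) * (0.57 * ‖x‖) := by
          have : 0 < η * ‖x‖ := by positivity
          nlinarith
      _ ≤ _ := by gcongr
  have hfin : ‖((0 : EuclideanSpace ℝ (Fin d)) - (η * f / ‖v‖ ^ 2) • v) - x‖ ^ 2
      ≤ ‖x‖ ^ 2 * (1 - η / (10 * √π * ‖x‖)) := by
    rw [hnorm]
    have : ‖x‖ ^ 2 * (1 - η / (10 * √π * ‖x‖)) = ‖x‖ ^ 2 - η * ‖x‖ / (10 * √π) := by
      field_simp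
    rw [this]; linarith
  calc _ ≤ √(‖x‖ ^ 2 * (1 - η / (10 * √π * ‖x‖))) := Real.le_sqrt_of_sq_le hfin
    _ = _ := by rw [Real.sqrt_mul (by positivity), Real.sqrt_sq hx0.le]

lemma aux_X2_val : 1 / √(2 * π) - 1 / 4 ≤ ∫ g, (1 - rexp (-max g 0)) ∂(gaussianReal 0 1) := by
  have h1 : ∫ g, (max g 0 - 1 / 2 * (max g 0) ^ 2) ∂(gaussianReal 0 1) = 1 / √(2 * π) - 1 / 4 := by
    rw [integral_sub aux_int_pos (aux_int_pos_sq.const_mul _), integral_const_mul, aux_pos_val,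
      aux_pos_sq_val]
    ring
  rw [← h1]
  refine integral_mono (aux_int_pos.sub (aux_int_pos_sq.const_mul _)) ?_ fun g => ?_
  · refine aux_int_pos.mono' (by fun_prop) (ae_of_all _ fun g => ?_)
    have h0 : 0 ≤ max g 0 := le_max_right _ _
    rw [Real.norm_of_nonneg]
    · have := Real.add_one_le_exp (-max g 0); linarith
    · have : rexp (-max g 0) ≤ 1 := Real.exp_le_one_iff.2 (by linarith)
      linarith
  · have := aux_exp_neg_le (max g 0) (le_max_right _ _)
    simp only
    linarith

lemma aux_P {d m : ℕ} (x : EuclideanSpace ℝ (Fin d)) (a : Fin m → EuclideanSpace ℝ (Fin d)) :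
    -⟪v0 x a, x⟫ = (1 / m) * ∑ i, max ⟪a i, x⟫ 0 := by
  unfold v0
  rw [inner_neg_left, neg_neg, inner_smul_left, sum_inner]
  simp only [conj_trivial]
  congr 1
  refine Finset.sum_congr rfl fun i _ => ?_
  split_ifs with h
  · rw [max_eq_left h.le]
  · rw [max_eq_right (not_lt.1 h), inner_zero_left]

lemma aux_loss {d m : ℕ} (x : EuclideanSpace ℝ (Fin d)) (a : Fin m → EuclideanSpace ℝ (Fin d)) :
    loss x a 0 = (1 / m) * ∑ i, (1 - rexp (-max ⟪a i, x⟫ 0)) := by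
  unfold loss
  congr 1
  refine Finset.sum_congr rfl fun i _ => ?_
  have h0 : 0 ≤ max ⟪a i, x⟫ 0 := le_max_right _ _
  have : rexp (-max ⟪a i, x⟫ 0) ≤ 1 := Real.exp_le_one_iff.2 (by linarith)
  simp only [inner_zero_right, max_self, neg_zero, Real.exp_zero, sub_self, sub_zero]
  rw [abs_of_nonneg (by linarith)]

/-- Properties at initialization: correlation of `v₀` with `-x⋆`, boundedness of `v₀`, and
contraction of the first Polyak step `x₁ = 0 - η (f(0)/‖v₀‖²) v₀`. -/
theorem initialization_properties :
    ∃ C : ℝ, 0 < C ∧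
      ∀ (d m : ℕ) (xstar : EuclideanSpace ℝ (Fin d)) (η : ℝ), 1 ≤ d → 1 ≤ m →
        1 ≤ ‖xstar‖ → C * d * ‖xstar‖ ^ 2 ≤ m → 0 < η → η ≤ 1 / 2 →
        ENNReal.ofReal (1 - 2 * Real.exp (-(d : ℝ)) - Real.exp (-(d : ℝ) / 2)) ≤
          iidGaussian d m {a |
            ‖xstar‖ * (1 / Real.sqrt (2 * π) - Real.sqrt (2 * d / m)) ≤ -⟪v0 xstar a, xstar⟫ ∧
            ‖v0 xstar a‖ ≤ 1 + 2 * Real.sqrt (d / m) ∧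
            ‖((0 : EuclideanSpace ℝ (Fin d)) -
                (η * loss xstar a 0 / ‖v0 xstar a‖ ^ 2) • v0 xstar a) - xstar‖
              ≤ ‖xstar‖ * Real.sqrt (1 - η / (10 * Real.sqrt π * ‖xstar‖))} := by
  refine ⟨10000, by norm_num, ?_⟩
  intro d m x η hd hm hx hC hη hη'
  have hm0 : (0:ℝ) < m := by exact_mod_cast hm
  have hd0 : (0:ℝ) ≤ d := by positivity
  have hmd : (10000:ℝ) * d ≤ m := by
    have h1 : (1:ℝ) ≤ ‖x‖ ^ 2 := one_le_pow₀ hx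
    nlinarith
  have hx0 : 0 < ‖x‖ := by linarith
  obtain ⟨u, hu, hxu⟩ : ∃ u : EuclideanSpace ℝ (Fin d), ‖u‖ = 1 ∧ x = ‖x‖ • u := by
    refine ⟨‖x‖⁻¹ • x, ?_, ?_⟩
    · rw [norm_smul, norm_inv, norm_norm, inv_mul_cancel₀ hx0.ne']
    · rw [smul_smul, mul_inv_cancel₀ hx0.ne', one_smul]
  have hin : ∀ y : EuclideanSpace ℝ (Fin d), ⟪y, x⟫ = ‖x‖ * ⟪y, u⟫ := by
    intro y
    conv_lhs => rw [hxu, inner_smul_right]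
  have hmax : ∀ y : EuclideanSpace ℝ (Fin d), max ⟪y, x⟫ 0 = ‖x‖ * max ⟪y, u⟫ 0 := by
    intro y
    rw [hin, mul_max_of_nonneg _ _ hx0.le, mul_zero]
  set t : ℝ := √(2 * d / m) with ht
  have ht2 : t ≤ 0.015 := by
    rw [ht, Real.sqrt_le_left (by norm_num), div_le_iff₀ hm0]
    norm_num
    linarith
  have hc := aux_c_lower
  -- the bad events
  have B1 := aux_lower_tail d m u hu (fun g => max g 0) (by fun_prop) (fun g => le_max_right _ _)
    (fun g => le_rfl) (1 / √(2 * π)) t aux_pos_val.ge (by positivity)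
  have B2 := aux_lower_tail d m u hu (fun g => 1 - rexp (-max g 0)) (by fun_prop)
    (fun g => by
      have : rexp (-max g 0) ≤ 1 := Real.exp_le_one_iff.2 (neg_nonpos.2 (le_max_right _ _))
      linarith)
    (fun g => by have := Real.add_one_le_exp (-max g 0); linarith)
    (1 / √(2 * π) - 1 / 4) (1 / 100) aux_X2_val (by norm_num)
  have B3 := aux_norm_tail' d m hm hmd x
  set b1 := {a : Fin m → EuclideanSpace ℝ (Fin d) |
    ∑ i, max ⟪a i, u⟫ 0 < m * (1 / √(2 * π) - t)}
  set b2 := {a : Fin m → EuclideanSpace ℝ (Fin d) |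
    ∑ i, (1 - rexp (-max ⟪a i, u⟫ 0)) < m * (1 / √(2 * π) - 1 / 4 - 1 / 100)}
  set b3 := {a : Fin m → EuclideanSpace ℝ (Fin d) | (m : ℝ) < ‖auxS x a‖}
  have B1' : iidGaussian d m b1 ≤ ENNReal.ofReal (rexp (-(d:ℝ))) := by
    refine B1.trans (ENNReal.ofReal_le_ofReal (Real.exp_le_exp.2 ?_))
    rw [ht, Real.sq_sqrt (by positivity), mul_div_cancel₀ _ hm0.ne']
    linarith
  have B2' : iidGaussian d m b2 ≤ ENNReal.ofReal (rexp (-(d:ℝ))) := by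
    refine B2.trans (ENNReal.ofReal_le_ofReal (Real.exp_le_exp.2 ?_))
    norm_num
    linarith
  set good := {a : Fin m → EuclideanSpace ℝ (Fin d) | _} with hgood
  have hsub : goodᶜ ⊆ b1 ∪ (b2 ∪ b3) := by
    intro a ha
    by_contra hb
    apply ha
    simp only [b1, b2, b3, Set.mem_union, Set.mem_ofPred_eq, not_or, not_lt] at hb
    obtain ⟨g1, g2, g3⟩ := hb
    have hP : ‖x‖ * (1 / √(2 * π) - t) ≤ -⟪v0 x a, x⟫ := by
      rw [aux_P]
      simp_rw [hmax]
      rw [← Finset.mul_sum, mul_left_comm]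
      refine mul_le_mul_of_nonneg_left ?_ hx0.le
      rw [one_div_mul_eq_div, le_div_iff₀ hm0]
      linarith
    have hv : ‖v0 x a‖ ≤ 1 := by
      have : v0 x a = -((1 / m : ℝ) • auxS x a) := rfl
      rw [this, norm_neg, norm_smul, Real.norm_of_nonneg (by positivity), one_div_mul_eq_div,
        div_le_one hm0]
      exact g3
    refine ⟨hP, ?_, ?_⟩
    · have : 0 ≤ √((d:ℝ) / m) := by positivity
      linarith
    · apply aux_contract _ _ _ _ hη hη' hx _ _ _ hv
      · refine le_trans ?_ hP
        rw [mul_comm]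
        refine mul_le_mul_of_nonneg_left ?_ hx0.le
        linarith
      · rw [aux_loss, one_div_mul_eq_div, le_div_iff₀ hm0]
        have h1 : ∑ i, (1 - rexp (-max ⟪a i, u⟫ 0)) ≤ ∑ i, (1 - rexp (-max ⟪a i, x⟫ 0)) := by
          refine Finset.sum_le_sum fun i _ => ?_
          have h0 : 0 ≤ max ⟪a i, u⟫ 0 := le_max_right _ _
          have : rexp (-max ⟪a i, x⟫ 0) ≤ rexp (-max ⟪a i, u⟫ 0) := by
            apply Real.exp_le_exp.2
            rw [hmax]
            nlinarith
          linarith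
        nlinarith
      · rw [aux_loss, aux_P]
        refine mul_le_mul_of_nonneg_left ?_ (by positivity)
        refine Finset.sum_le_sum fun i _ => ?_
        have := Real.add_one_le_exp (-max ⟪a i, x⟫ 0)
        linarith
  have hbad : iidGaussian d m goodᶜ ≤ ENNReal.ofReal (2 * rexp (-(d:ℝ)) + rexp (-(d:ℝ) / 2)) := by
    calc _ ≤ _ := measure_mono hsub
      _ ≤ _ := (measure_union_le _ _).trans (add_le_add le_rfl (measure_union_le _ _))
      _ ≤ _ := add_le_add B1' (add_le_add B2' B3)
      _ = _ := by
        rw [← ENNReal.ofReal_add (by positivity) (by positivity),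
          ← ENNReal.ofReal_add (by positivity) (by positivity)]
        congr 1; ring
  have huniv : 1 ≤ iidGaussian d m good + iidGaussian d m goodᶜ := by
    rw [← measure_univ (μ := iidGaussian d m)]
    exact measure_univ_le_add_compl good
  rw [sub_sub, ENNReal.ofReal_sub _ (by positivity), ENNReal.ofReal_one]
  rw [tsub_le_iff_right]
  exact huniv.trans (add_le_add le_rfl hbad)
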